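/- Per-step variance bound for single-sample Randomized Forward (rigorous form of Theorem 3's single-step bound): for every step t and state i, writing ε_t(j,i) = α_t(j)Φ_t(j,i)/α_{t+1}(i) − q_t(j) and J_t = max_{1≤j≤N} E[α̂_t(j)²]/α_t(j)², one has Var[α̂_{t+1}(i)] ≤ α_{t+1}(i)² · ( J_t · (1 + Σ_{j=1}^N ε_t(j,i)²/q_t(j)) − 1 ); in particular the variance bound shrinks as the proposal gaps ε_t(j,i) shrink, and vanishes when J_t = 1 and ε_t(·,i) ≡ 0. -/

import Mathlib

open Finset

/-- Exact forward recursion, 0-based: `forwardAlpha α1 Φ (t-1)` is the paper's `α_t`. -/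
def forwardAlpha {N : ℕ} (α1 : Fin N → ℝ) (Φ : ℕ → Fin N → Fin N → ℝ) :
    ℕ → Fin N → ℝ
  | 0 => α1
  | t + 1 => fun i => ∑ j, forwardAlpha α1 Φ t j * Φ t j i

/-- Single-sample randomized forward recursion (the case `K1 = 0`, `K2 = 1` of
Randomized Forward), 0-based, for a fixed realization `δ` of the samples. -/
noncomputable def ssForwardAlpha {N : ℕ} (α1 : Fin N → ℝ)
    (Φ : ℕ → Fin N → Fin N → ℝ) (q : ℕ → Fin N → ℝ) (δ : ℕ → Fin N) :
    ℕ → Fin N → ℝ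
  | 0 => α1
  | t + 1 => fun i => ssForwardAlpha α1 Φ q δ t (δ t) * Φ t (δ t) i / q t (δ t)

/-- If `F δ` does not depend on the coordinate `δ a`, then under product weights the coordinate
`δ a` may be sampled independently of the rest. -/
theorem sum_prod_mul_apply_eq_sum_mul_sum {ι κ : Type*} [Fintype ι] [DecidableEq ι] [Fintype κ]
    (w : ι → κ → ℝ) (a : ι) (hw : ∑ k, w a k = 1) (F : (ι → κ) → κ → ℝ)
    (hF : ∀ δ k, F (Function.update δ a k) = F δ) :
    ∑ δ : ι → κ, (∏ u, w u (δ u)) * F δ (δ a) =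
      ∑ k, w a k * ∑ δ : ι → κ, (∏ u, w u (δ u)) * F δ k := by
  have hinv : Function.Involutive
      (fun p : κ × (ι → κ) => (p.2 a, Function.update p.2 a p.1)) := by
    rintro ⟨k, δ⟩
    simp
  have hweight : ∀ (k : κ) (δ : ι → κ),
      w a (δ a) * ∏ u, w u (Function.update δ a k u) = w a k * ∏ u, w u (δ u) := by
    intro k δ
    rw [← Finset.mul_prod_erase _ _ (Finset.mem_univ a),
      ← Finset.mul_prod_erase _ (fun u => w u (δ u)) (Finset.mem_univ a),
      Function.update_self, Finset.prod_congr rfl (g := fun u => w u (δ u))]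
    · ring
    · intro u hu
      rw [Function.update_of_ne (Finset.ne_of_mem_erase hu)]
  calc ∑ δ : ι → κ, (∏ u, w u (δ u)) * F δ (δ a)
      = ∑ p : κ × (ι → κ), w a p.1 * ((∏ u, w u (p.2 u)) * F p.2 (p.2 a)) := by
        simp only [Fintype.sum_prod_type, ← Finset.mul_sum]
        rw [← Finset.sum_mul, hw, one_mul]
    _ = ∑ p : κ × (ι → κ), w a p.1 * ((∏ u, w u (p.2 u)) * F p.2 p.1) := by
        rw [← Equiv.sum_comp hinv.toPerm]
        refine Finset.sum_congr rfl fun p _ => ?_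
        simp only [Function.Involutive.coe_toPerm, Function.update_self, hF]
        rw [← mul_assoc, hweight, mul_assoc]
    _ = _ := by
        rw [Fintype.sum_prod_type]
        simp only [Finset.mul_sum]

theorem forwardAlpha_pos {N : ℕ} (hN : 0 < N) {α1 : Fin N → ℝ} (hα1 : ∀ i, 0 < α1 i)
    {Φ : ℕ → Fin N → Fin N → ℝ} (hΦ : ∀ t i j, 0 < Φ t i j) (t : ℕ) (i : Fin N) :
    0 < forwardAlpha α1 Φ t i := by
  induction t generalizing i with
  | zero => exact hα1 i
  | succ t ih =>
    exact Finset.sum_pos (fun j _ => mul_pos (ih j) (hΦ t j i)) ⟨⟨0, hN⟩, Finset.mem_univ _⟩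

/-- The randomized forward vector at step `t` depends only on the samples before `t`. -/
theorem ssForwardAlpha_congr {N : ℕ} (α1 : Fin N → ℝ) (Φ : ℕ → Fin N → Fin N → ℝ)
    (q : ℕ → Fin N → ℝ) {δ δ' : ℕ → Fin N} (t : ℕ) (h : ∀ u < t, δ u = δ' u) :
    ssForwardAlpha α1 Φ q δ t = ssForwardAlpha α1 Φ q δ' t := by
  induction t with
  | zero => rfl
  | succ t ih =>
    funext i
    simp only [ssForwardAlpha, ih fun u hu => h u (hu.trans t.lt_succ_self), h t t.lt_succ_self]

/-- The expectation of the `n`-th power of the randomized forward vector satisfies a linear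
recursion. -/
theorem sum_ssForwardAlpha_succ_pow {N T : ℕ} (hN : 0 < N) (α1 : Fin N → ℝ)
    (Φ : ℕ → Fin N → Fin N → ℝ) (q : ℕ → Fin N → ℝ) (hq_sum : ∀ t, ∑ j, q t j = 1)
    (n t : ℕ) (ht : t < T) (i : Fin N) :
    ∑ δ : Fin T → Fin N, (∏ u : Fin T, q u.1 (δ u)) *
        ssForwardAlpha α1 Φ q
          (fun u => if h : u < T then δ ⟨u, h⟩ else ⟨0, hN⟩) (t + 1) i ^ n =
      ∑ j, q t j * ((∑ δ : Fin T → Fin N, (∏ u : Fin T, q u.1 (δ u)) *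
        ssForwardAlpha α1 Φ q
          (fun u => if h : u < T then δ ⟨u, h⟩ else ⟨0, hN⟩) t j ^ n) *
          (Φ t j i / q t j) ^ n) := by
  have key := sum_prod_mul_apply_eq_sum_mul_sum (fun u : Fin T => q u.1) ⟨t, ht⟩ (hq_sum t)
    (fun δ j => ssForwardAlpha α1 Φ q
      (fun u => if h : u < T then δ ⟨u, h⟩ else ⟨0, hN⟩) t j ^ n * (Φ t j i / q t j) ^ n) ?_
  · simp only [ssForwardAlpha, dif_pos ht, mul_div_assoc, mul_pow]
    rw [key]
    simp only [Finset.sum_mul, mul_assoc]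
  · intro δ k
    funext j
    congr 2
    refine congrFun (ssForwardAlpha_congr α1 Φ q t fun u hu => ?_) j
    have hne : (⟨u, hu.trans ht⟩ : Fin T) ≠ ⟨t, ht⟩ := by
      simpa using hu.ne
    simp only [dif_pos (hu.trans ht), Function.update_of_ne hne]

/-- The randomized forward recursion is unbiased. -/
theorem sum_ssForwardAlpha_eq_forwardAlpha {N T : ℕ} (hN : 0 < N) (α1 : Fin N → ℝ)
    (Φ : ℕ → Fin N → Fin N → ℝ) (q : ℕ → Fin N → ℝ) (hq_pos : ∀ t j, 0 < q t j)
    (hq_sum : ∀ t, ∑ j, q t j = 1) (t : ℕ) (ht : t ≤ T) (i : Fin N) :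
    ∑ δ : Fin T → Fin N, (∏ u : Fin T, q u.1 (δ u)) *
        ssForwardAlpha α1 Φ q
          (fun u => if h : u < T then δ ⟨u, h⟩ else ⟨0, hN⟩) t i =
      forwardAlpha α1 Φ t i := by
  induction t generalizing i with
  | zero =>
    simp only [ssForwardAlpha, forwardAlpha]
    rw [← Finset.sum_mul, ← Fintype.prod_sum (fun (u : Fin T) j => q u.1 j)]
    simp [hq_sum]
  | succ t ih =>
    have h := sum_ssForwardAlpha_succ_pow hN α1 Φ q hq_sum 1 t ht i
    simp only [pow_one] at h
    rw [h]
    refine Finset.sum_congr rfl fun j _ => ?_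
    rw [ih (Nat.le_of_succ_le ht) j]
    field_simp [(hq_pos t j).ne']

/-- rigorous form of Theorem 3's single-step bound: per-step variance
bound for single-sample Randomized Forward. With proposal gaps
`ε_t(j,i) = α_t(j)Φ_t(j,i)/α_{t+1}(i) − q_t(j)` and relative second moment
`J_t = max_j E[α̂_t(j)²]/α_t(j)²`, one has
`Var[α̂_{t+1}(i)] ≤ α_{t+1}(i)²·(J_t·(1 + Σ_j ε_t(j,i)²/q_t(j)) − 1)`;
in particular the bound vanishes when `J_t = 1` and `ε_t(·,i) ≡ 0`.
Expectations are explicit weighted sums over sample realizations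
`δ : Fin T → Fin N` with i.i.d. weights `∏_s q_s(δ_s)`, and
`Var[X] = E[X²] − (E[X])²`. -/
theorem ss_forward_single_step_variance_bound
    (N T : ℕ) (hN : 0 < N)
    (α1 : Fin N → ℝ) (hα1 : ∀ i, 0 < α1 i)
    (Φ : ℕ → Fin N → Fin N → ℝ) (hΦ : ∀ t i j, 0 < Φ t i j)
    (q : ℕ → Fin N → ℝ) (hq_pos : ∀ t j, 0 < q t j)
    (hq_sum : ∀ t, ∑ j, q t j = 1)
    (t : ℕ) (ht : t + 1 < T) (i : Fin N) :
    let E2 : ℕ → Fin N → ℝ := fun s j =>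
      ∑ δ : Fin T → Fin N,
        (∏ u : Fin T, q u.1 (δ u)) *
          (ssForwardAlpha α1 Φ q
            (fun u => if h : u < T then δ ⟨u, h⟩ else ⟨0, hN⟩) s j) ^ 2
    let E1 : ℝ :=
      ∑ δ : Fin T → Fin N,
        (∏ u : Fin T, q u.1 (δ u)) *
          ssForwardAlpha α1 Φ q
            (fun u => if h : u < T then δ ⟨u, h⟩ else ⟨0, hN⟩) (t + 1) i
    let ε : Fin N → ℝ := fun j =>
      forwardAlpha α1 Φ t j * Φ t j i / forwardAlpha α1 Φ (t + 1) i - q t j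
    let J : ℝ := Finset.univ.sup' ⟨⟨0, hN⟩, Finset.mem_univ _⟩
      (fun j => E2 t j / (forwardAlpha α1 Φ t j) ^ 2)
    E2 (t + 1) i - E1 ^ 2 ≤
        (forwardAlpha α1 Φ (t + 1) i) ^ 2 *
          (J * (1 + ∑ j, (ε j) ^ 2 / q t j) - 1) ∧
      ((J = 1 ∧ ∀ j, ε j = 0) →
        (forwardAlpha α1 Φ (t + 1) i) ^ 2 *
          (J * (1 + ∑ j, (ε j) ^ 2 / q t j) - 1) = 0) := by
  intro E2 E1 ε J
  have hα := forwardAlpha_pos hN hα1 hΦ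
  have hA := hα (t + 1) i
  have hE1 : E1 = forwardAlpha α1 Φ (t + 1) i :=
    sum_ssForwardAlpha_eq_forwardAlpha hN α1 Φ q hq_pos hq_sum (t + 1) ht.le i
  have hE2 : E2 (t + 1) i = ∑ j, q t j * (E2 t j * (Φ t j i / q t j) ^ 2) :=
    sum_ssForwardAlpha_succ_pow hN α1 Φ q hq_sum 2 t (Nat.lt_of_succ_lt ht) i
  have hJ : ∀ j, E2 t j ≤ J * forwardAlpha α1 Φ t j ^ 2 := fun j =>
    (div_le_iff₀ (pow_pos (hα t j) 2)).mp
      (Finset.le_sup' (fun j => E2 t j / forwardAlpha α1 Φ t j ^ 2) (Finset.mem_univ j))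
  have hε : ∑ j, ε j = 0 := by
    simp only [ε]
    rw [Finset.sum_sub_distrib, ← Finset.sum_div, hq_sum t, sub_eq_zero]
    exact div_self hA.ne'
  have hsum : ∑ j, (ε j + q t j) ^ 2 / q t j = 1 + ∑ j, ε j ^ 2 / q t j := by
    have h : ∀ j, (ε j + q t j) ^ 2 / q t j = ε j ^ 2 / q t j + 2 * ε j + q t j := by
      intro j
      have := (hq_pos t j).ne'
      field_simp
      ring
    simp only [h, Finset.sum_add_distrib, ← Finset.mul_sum, hε, hq_sum t]
    ring
  refine ⟨?_, fun ⟨hJ1, hε0⟩ => by simp [hJ1, hε0]⟩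
  have hbound : E2 (t + 1) i ≤
      forwardAlpha α1 Φ (t + 1) i ^ 2 * (J * (1 + ∑ j, ε j ^ 2 / q t j)) := by
    rw [hE2, ← hsum, Finset.mul_sum, Finset.mul_sum]
    refine Finset.sum_le_sum fun j _ => ?_
    have hq := hq_pos t j
    calc q t j * (E2 t j * (Φ t j i / q t j) ^ 2)
        ≤ q t j * (J * forwardAlpha α1 Φ t j ^ 2 * (Φ t j i / q t j) ^ 2) := by
          gcongr
          exact hJ j
      _ = _ := by
          simp only [ε, sub_add_cancel]
          field_simp
  rw [hE1]
  linarith
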